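/- arXiv:1710.09806 — 7 statements merged into one kernel-verified Lean document; each statement's English description precedes it below -/
import Mathlib

section
/- Let ℓ, m be natural numbers and s a nonnegative real number with ℓ = m + ⌈s⌉ + 2. Let 𝓗 be a finite nonempty universal family of functions from (Fin ℓ → ZMod 2) to (Fin m → ZMod 2). Then for every finite set S of vectors in (Fin ℓ → ZMod 2) with |S| ≥ 2^(ℓ − s) (as a real-number inequality), at least a quarter of the members of 𝓗 are good for S, i.e., 4 · |{h ∈ 𝓗 : (∃ σ ∈ S, h σ = 0) and |{τ : h τ = 0}| ≤ 2^(⌈s⌉ + 3)}| ≥ |𝓗|. -/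
section UniversalHashing

variable {α β : Type*} [DecidableEq β]

/-- In a pairwise independent family, each single value is uniformly distributed. -/
lemma card_mul_card_filter_apply_eq [Fintype β] [Nontrivial α] [Nonempty β] {H : Finset (α → β)}
    (hH : ∀ a b : α, a ≠ b → ∀ y z : β,
      Fintype.card β ^ 2 * (H.filter fun h => h a = y ∧ h b = z).card = H.card) (a : α) (y : β) :
    Fintype.card β * (H.filter fun h => h a = y).card = H.card := by
  obtain ⟨b, hb⟩ := exists_ne a
  have hsum : (H.filter fun h => h a = y).card
      = ∑ z : β, (H.filter fun h => h a = y ∧ h b = z).card := by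
    rw [Finset.card_eq_sum_card_fiberwise (f := fun h => h b) (t := Finset.univ) (by simp)]
    simp only [Finset.filter_filter]
  apply Nat.eq_of_mul_eq_mul_left (Fintype.card_pos (α := β))
  rw [← mul_assoc, ← sq, hsum, Finset.mul_sum, Finset.sum_congr rfl fun z _ => hH a b hb.symm y z]
  simp

/-- The total number of points of `S` sent to `y` by the members of a family
with uniformly distributed values. -/
lemma mul_sum_card_filter_apply_eq {H : Finset (α → β)} {M : ℕ} {y : β}
    (hH : ∀ a, M * (H.filter fun h => h a = y).card = H.card) (S : Finset α) :
    M * ∑ h ∈ H, (S.filter fun a => h a = y).card = S.card * H.card := by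
  have hswap := Finset.sum_card_bipartiteAbove_eq_sum_card_bipartiteBelow
    (s := H) (t := S) (fun h a => h a = y)
  simp only [Finset.bipartiteAbove, Finset.bipartiteBelow] at hswap
  rw [hswap, Finset.mul_sum, Finset.sum_congr rfl fun a _ => hH a]
  simp

/-- The second moment of the number of points of `S` sent to `y` by a pairwise independent
family. -/
lemma sq_mul_sum_card_filter_apply_sq {H : Finset (α → β)} {M : ℕ} {y : β}
    (hone : ∀ a, M * (H.filter fun h => h a = y).card = H.card)
    (htwo : ∀ a b, a ≠ b → M ^ 2 * (H.filter fun h => h a = y ∧ h b = y).card = H.card)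
    (S : Finset α) :
    (M : ℝ) ^ 2 * ∑ h ∈ H, ((S.filter fun a => h a = y).card : ℝ) ^ 2
      = S.card * M * H.card + (S.card ^ 2 - S.card) * H.card := by
  classical
  have hsq (h : α → β) : (S.filter fun a => h a = y).card ^ 2
      = ((S ×ˢ S).filter fun p => h p.1 = y ∧ h p.2 = y).card := by
    rw [Finset.filter_product (fun a => h a = y) (fun a => h a = y), Finset.card_product, sq]
  have hswap := Finset.sum_card_bipartiteAbove_eq_sum_card_bipartiteBelow
    (s := H) (t := S ×ˢ S) (fun h p => h p.1 = y ∧ h p.2 = y)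
  simp only [Finset.bipartiteAbove, Finset.bipartiteBelow, ← hsq] at hswap
  have hpair (a b : α) : (M : ℝ) ^ 2 * ((H.filter fun h => h a = y ∧ h b = y).card : ℝ)
      = H.card + if a = b then (M - 1 : ℝ) * H.card else 0 := by
    split_ifs with hab
    · subst hab
      have := hone a
      simp only [and_self]
      rw [← this]
      push_cast
      ring
    · rw [add_zero]
      exact_mod_cast htwo a b hab
  have hswap' : ∑ h ∈ H, ((S.filter fun a => h a = y).card : ℝ) ^ 2
      = ∑ p ∈ S ×ˢ S, ((H.filter fun h => h p.1 = y ∧ h p.2 = y).card : ℝ) := by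
    exact_mod_cast hswap
  rw [hswap', Finset.mul_sum, Finset.sum_product]
  simp only [hpair, Finset.sum_add_distrib, Finset.sum_ite_eq, Finset.sum_const, nsmul_eq_mul,
    Finset.sum_ite_mem, Finset.inter_self]
  ring

/-- Chebyshev's inequality: few members of a pairwise independent family miss `y` on all
of `S`. -/
lemma card_mul_card_filter_forall_ne_le {H : Finset (α → β)} {M : ℕ} {y : β}
    (hone : ∀ a, M * (H.filter fun h => h a = y).card = H.card)
    (htwo : ∀ a b, a ≠ b → M ^ 2 * (H.filter fun h => h a = y ∧ h b = y).card = H.card)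
    (S : Finset α) :
    S.card * (H.filter fun h => ∀ a ∈ S, h a ≠ y).card ≤ M * H.card := by
  rcases S.eq_empty_or_nonempty with rfl | hS
  · simp
  set X : (α → β) → ℝ := fun h => ((S.filter fun a => h a = y).card : ℝ) with hX
  have hfirst : (M : ℝ) * ∑ h ∈ H, X h = S.card * H.card := by
    simp only [hX]
    exact_mod_cast mul_sum_card_filter_apply_eq hone S
  have hsecond : (M : ℝ) ^ 2 * ∑ h ∈ H, X h ^ 2
      = S.card * M * H.card + (S.card ^ 2 - S.card) * H.card :=
    sq_mul_sum_card_filter_apply_sq hone htwo S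
  have hvar : ∑ h ∈ H, ((M : ℝ) * X h - S.card) ^ 2 = S.card * M * H.card - S.card * H.card := by
    have hexp : ∑ h ∈ H, ((M : ℝ) * X h - S.card) ^ 2
        = M ^ 2 * ∑ h ∈ H, X h ^ 2 - 2 * S.card * (M * ∑ h ∈ H, X h) + H.card * S.card ^ 2 := by
      rw [Finset.mul_sum, Finset.mul_sum, Finset.mul_sum, ← Finset.sum_sub_distrib,
        ← nsmul_eq_mul H.card, ← Finset.sum_const, ← Finset.sum_add_distrib]
      exact Finset.sum_congr rfl fun h _ => by ring
    rw [hexp, hfirst, hsecond]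
    ring
  have hle : ((H.filter fun h => ∀ a ∈ S, h a ≠ y).card : ℝ) * S.card ^ 2
      ≤ ∑ h ∈ H, ((M : ℝ) * X h - S.card) ^ 2 := by
    rw [← nsmul_eq_mul, ← Finset.sum_const]
    calc _ = ∑ h ∈ H.filter (fun h => ∀ a ∈ S, h a ≠ y), ((M : ℝ) * X h - S.card) ^ 2 := by
          refine Finset.sum_congr rfl fun h hh => ?_
          have : X h = 0 := by
            simp only [hX, Nat.cast_eq_zero, Finset.card_eq_zero]
            exact Finset.filter_eq_empty_iff.2 fun a ha => (Finset.mem_filter.1 hh).2 a ha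
          rw [this]
          ring
      _ ≤ _ := Finset.sum_le_sum_of_subset_of_nonneg (Finset.filter_subset _ _)
          fun _ _ _ => sq_nonneg _
  have hpos : (0 : ℝ) < S.card := by exact_mod_cast hS.card_pos
  have hfinal : (S.card : ℝ) * (H.filter fun h => ∀ a ∈ S, h a ≠ y).card ≤ M * H.card := by
    refine le_of_mul_le_mul_left ?_ hpos
    have : (0 : ℝ) ≤ S.card * H.card := by positivity
    nlinarith
  exact_mod_cast hfinal

/-- Markov's inequality for a sum of natural numbers over a finite set. -/
lemma mul_card_filter_lt_le_sum {ι : Type*} (s : Finset ι) (f : ι → ℕ) (c : ℕ) :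
    c * (s.filter fun i => c < f i).card ≤ ∑ i ∈ s, f i := by
  calc c * (s.filter fun i => c < f i).card = ∑ _i ∈ s.filter (fun i => c < f i), c := by
        rw [Finset.sum_const, smul_eq_mul, mul_comm]
    _ ≤ ∑ i ∈ s.filter (fun i => c < f i), f i :=
        Finset.sum_le_sum fun i hi => (Finset.mem_filter.1 hi).2.le
    _ ≤ _ := Finset.sum_le_sum_of_subset (Finset.filter_subset _ _)

end UniversalHashing

/-- **Part 1 of the hashing claim (Claim 4.2, part 1).**
If `𝓗` is a universal family of hash functions from `{0,1}^ℓ` to `{0,1}^m`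
with `ℓ = m + ⌈s⌉ + 2`, then for every set `S ⊆ {0,1}^ℓ` with `|S| ≥ 2^{ℓ-s}`,
at least a quarter of the hash functions `h ∈ 𝓗` satisfy:
some `σ ∈ S` has `h σ = 0`, and `|h⁻¹(0)| ≤ 2^{⌈s⌉+3}`. -/
theorem stmt0 (ℓ m : ℕ) (s : ℝ) (hs : 0 ≤ s) (hℓ : ℓ = m + ⌈s⌉₊ + 2)
    (𝓗 : Finset ((Fin ℓ → ZMod 2) → (Fin m → ZMod 2))) (h𝓗 : 𝓗.Nonempty)
    (huniv : ∀ σ0 σ1 : Fin ℓ → ZMod 2, σ0 ≠ σ1 → ∀ y0 y1 : Fin m → ZMod 2,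
      2 ^ (2 * m) * (𝓗.filter fun h => h σ0 = y0 ∧ h σ1 = y1).card = 𝓗.card)
    (S : Finset (Fin ℓ → ZMod 2)) (hS : (2:ℝ) ^ ((ℓ:ℝ) - s) ≤ (S.card : ℝ)) :
    4 * (𝓗.filter fun h => (∃ σ ∈ S, h σ = 0)
        ∧ (Finset.univ.filter fun τ : Fin ℓ → ZMod 2 => h τ = 0).card ≤ 2 ^ (⌈s⌉₊ + 3)).card
      ≥ 𝓗.card := by
  have hcardβ : Fintype.card (Fin m → ZMod 2) = 2 ^ m := by simp
  have hcardα : (Finset.univ : Finset (Fin ℓ → ZMod 2)).card = 2 ^ ℓ := by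
    simp [Finset.card_univ]
  have : Nonempty (Fin ℓ) := ⟨⟨0, by omega⟩⟩
  have hone (σ : Fin ℓ → ZMod 2) : 2 ^ m * (𝓗.filter fun h => h σ = 0).card = 𝓗.card := by
    rw [← hcardβ]
    refine card_mul_card_filter_apply_eq (fun a b hab y z => ?_) σ 0
    rw [hcardβ, ← pow_mul, mul_comm m 2]
    exact huniv a b hab y z
  have htwo (a b : Fin ℓ → ZMod 2) (hab : a ≠ b) :
      (2 ^ m) ^ 2 * (𝓗.filter fun h => h a = 0 ∧ h b = 0).card = 𝓗.card := by
    rw [← pow_mul, mul_comm m 2]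
    exact huniv a b hab 0 0
  have hScard : 4 * 2 ^ m ≤ S.card := by
    have hexp : ((m + 2 : ℕ) : ℝ) ≤ (ℓ : ℝ) - s := by
      have := Nat.le_ceil s
      rw [hℓ]
      push_cast
      linarith
    have hle := (Real.rpow_le_rpow_of_exponent_le one_le_two hexp).trans hS
    rw [Real.rpow_natCast] at hle
    have hnat : 2 ^ (m + 2) ≤ S.card := by exact_mod_cast hle
    rw [pow_add] at hnat
    omega
  have hmiss : 4 * (𝓗.filter fun h => ∀ σ ∈ S, h σ ≠ 0).card ≤ 𝓗.card := by
    refine Nat.le_of_mul_le_mul_left ?_ (pow_pos two_pos m)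
    calc 2 ^ m * (4 * (𝓗.filter fun h => ∀ σ ∈ S, h σ ≠ 0).card)
        = 4 * 2 ^ m * (𝓗.filter fun h => ∀ σ ∈ S, h σ ≠ 0).card := by ring
      _ ≤ S.card * (𝓗.filter fun h => ∀ σ ∈ S, h σ ≠ 0).card := Nat.mul_le_mul_right _ hScard
      _ ≤ 2 ^ m * 𝓗.card := by convert card_mul_card_filter_forall_ne_le hone htwo S
  have hlarge : 2 * (𝓗.filter fun h => 2 ^ (⌈s⌉₊ + 3) <
      (Finset.univ.filter fun τ : Fin ℓ → ZMod 2 => h τ = 0).card).card ≤ 𝓗.card := by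
    have hmarkov := mul_card_filter_lt_le_sum 𝓗
      (fun h => (Finset.univ.filter fun τ : Fin ℓ → ZMod 2 => h τ = 0).card) (2 ^ (⌈s⌉₊ + 3))
    have hsum := mul_sum_card_filter_apply_eq hone Finset.univ
    rw [hcardα] at hsum
    refine Nat.le_of_mul_le_mul_left ?_ (pow_pos two_pos ℓ)
    rw [← hsum]
    refine le_trans (le_of_eq ?_) (Nat.mul_le_mul_left _ hmarkov)
    have hpow : 2 ^ ℓ * 2 = 2 ^ m * 2 ^ (⌈s⌉₊ + 3) := by
      rw [← pow_succ, ← pow_add]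
      congr 1
      omega
    rw [← mul_assoc, ← mul_assoc, hpow]
  have hcover : 𝓗.card ≤ (𝓗.filter fun h => (∃ σ ∈ S, h σ = 0)
        ∧ (Finset.univ.filter fun τ : Fin ℓ → ZMod 2 => h τ = 0).card ≤ 2 ^ (⌈s⌉₊ + 3)).card
      + ((𝓗.filter fun h => ∀ σ ∈ S, h σ ≠ 0).card
      + (𝓗.filter fun h => 2 ^ (⌈s⌉₊ + 3) <
        (Finset.univ.filter fun τ : Fin ℓ → ZMod 2 => h τ = 0).card).card) := by
    rw [← Finset.card_filter_add_card_filter_not (s := 𝓗) (fun h => (∃ σ ∈ S, h σ = 0)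
        ∧ (Finset.univ.filter fun τ : Fin ℓ → ZMod 2 => h τ = 0).card ≤ 2 ^ (⌈s⌉₊ + 3))]
    gcongr
    refine le_trans (Finset.card_le_card fun h hh => ?_) (Finset.card_union_le _ _)
    simp only [Finset.mem_union, Finset.mem_filter] at hh ⊢
    rcases not_and_or.1 hh.2 with hmem | hlt
    · push Not at hmem
      exact Or.inl ⟨hh.1, hmem⟩
    · exact Or.inr ⟨hh.1, not_le.1 hlt⟩
  omega
end

section
/- Let H be a finite nonempty type, Y a finite type, P : H → Y → Prop a predicate, and k a natural number. Suppose that for every y ∈ Y, 4 · |{h ∈ H : P h y}| ≥ |H| (each y is covered by at least a quarter of the elements of H), and that |Y| · 3^k < 4^k. Then there exists a function f : Fin k → H such that for every y ∈ Y there is an index i ∈ Fin k with P (f i) y. -/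
/-- **Union-bound covering argument.**
If every `y ∈ Y` is covered (`P h y`) by at least a quarter of the elements
`h` of a finite nonempty type `H`, and `|Y| · 3^k < 4^k`, then some sequence
of `k` elements of `H` covers every `y ∈ Y`. -/
theorem stmt3 (H Y : Type*) [Fintype H] [Nonempty H] [Fintype Y]
    (P : H → Y → Prop) (k : ℕ)
    (hcov : ∀ y : Y, 4 * Nat.card {h : H // P h y} ≥ Fintype.card H)
    (hk : Fintype.card Y * 3 ^ k < 4 ^ k) :
    ∃ f : Fin k → H, ∀ y : Y, ∃ i : Fin k, P (f i) y := by
  classical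
  set B : Y → Finset H := fun y => Finset.univ.filter fun h => ¬ P h y with hB
  have card_B_le (y : Y) : 4 * (B y).card ≤ 3 * Fintype.card H := by
    have hsum := Finset.card_filter_add_card_filter_not (s := (Finset.univ : Finset H))
      (fun h => P h y)
    have hy := hcov y
    rw [Nat.card_eq_fintype_card, Fintype.card_subtype] at hy
    rw [Finset.card_univ] at hsum
    simp only [hB]
    omega
  by_contra! hbad
  have hcover : (Finset.univ : Finset (Fin k → H)) ⊆
      Finset.univ.biUnion fun y => Fintype.piFinset fun _ => B y := by
    intro f _
    obtain ⟨y, hy⟩ := hbad f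
    simpa [hB] using ⟨y, hy⟩
  have hcount : Fintype.card H ^ k ≤ ∑ y, (B y).card ^ k := by
    simpa using (Finset.card_le_card hcover).trans Finset.card_biUnion_le
  have hle : 4 ^ k * Fintype.card H ^ k ≤ Fintype.card Y * 3 ^ k * Fintype.card H ^ k :=
    calc 4 ^ k * Fintype.card H ^ k ≤ 4 ^ k * ∑ y, (B y).card ^ k := by gcongr
      _ = ∑ y, (4 * (B y).card) ^ k := by simp only [Finset.mul_sum, mul_pow]
      _ ≤ ∑ _y : Y, (3 * Fintype.card H) ^ k :=
        Finset.sum_le_sum fun y _ => Nat.pow_le_pow_left (card_B_le y) k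
      _ = Fintype.card Y * 3 ^ k * Fintype.card H ^ k := by simp [mul_pow, mul_assoc]
  exact hk.not_ge (Nat.le_of_mul_le_mul_right hle (pow_pos Fintype.card_pos k))
end

section
/- Let ℓ, s be natural numbers with s ≥ 1 and ℓ ≥ s + 2, and set m = ℓ − s − 2. Let T be a type and R : (Fin ℓ → ZMod 2) → T a function such that every element in the range of R has at least 2^(ℓ − s) preimages under R. Then there exist m × ℓ matrices U_1, …, U_{3s} over ZMod 2 and vectors v_1, …, v_{3s} ∈ (Fin m → ZMod 2) such that for every τ in the range of R there is an index i ∈ [3s] with: (a) |{σ ∈ (Fin ℓ → ZMod 2) : U_i.mulVec σ + v_i = 0}| ≤ 2^(s + 3), and (b) there exists σ with U_i.mulVec σ + v_i = 0 and R σ = τ. -/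
open Finset in
/-- Second moment bound for a pairwise independent family of events `P · x`, each of probability
`1 / M`, over a uniform `h : H` with `Fintype.card H = K * M`. -/
lemma sum_sq_card_filter_sub_le {H X : Type*} [Fintype H] [DecidableEq X]
    (P : H → X → Prop) [∀ h x, Decidable (P h x)] (K M : ℕ)
    (hH : Fintype.card H = K * M) (h₁ : ∀ x, #{h | P h x} = K)
    (h₂ : ∀ x y, x ≠ y → #{h | P h x ∧ P h y} * M = K) (S : Finset X) :
    ∑ h, ((M : ℤ) * #{x ∈ S | P h x} - #S) ^ 2 ≤ K * M ^ 2 * #S := by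
  have hN : ∀ h, (#{x ∈ S | P h x} : ℤ) = ∑ x ∈ S, if P h x then 1 else 0 := by
    intro h; simp
  have e₁ : ∑ h, (#{x ∈ S | P h x} : ℤ) = K * #S := by
    simp_rw [hN]
    rw [sum_comm]
    simp [h₁, mul_comm]
  have e₂ : (M : ℤ) * ∑ h, (#{x ∈ S | P h x} : ℤ) ^ 2 ≤ K * M * #S + K * #S ^ 2 := by
    have hsq : ∑ h, (#{x ∈ S | P h x} : ℤ) ^ 2
        = ∑ x ∈ S, ∑ y ∈ S, (#{h | P h x ∧ P h y} : ℤ) := by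
      simp_rw [hN, sq, sum_mul_sum]
      rw [sum_comm]
      refine sum_congr rfl fun x _ => ?_
      rw [sum_comm]
      refine sum_congr rfl fun y _ => ?_
      simp [← ite_and, and_comm (a := P _ y)]
    have hxy : ∀ x y, (M : ℤ) * (#{h | P h x ∧ P h y} : ℤ) ≤ (if x = y then (K * M : ℤ) else 0) + K := by
      intro x y
      split_ifs with h
      · subst h
        simp only [and_self, h₁]
        nlinarith
      · have := h₂ x y h
        rw [mul_comm, ← this]
        simp
    rw [hsq, mul_sum]
    simp_rw [mul_sum]
    refine (sum_le_sum fun x _ => sum_le_sum fun y _ => hxy x y).trans (le_of_eq ?_)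
    simp only [sum_add_distrib, sum_ite_eq, sum_const, nsmul_eq_mul, sum_ite_mem, inter_self]
    ring
  have e₃ : ∑ h, ((M : ℤ) * #{x ∈ S | P h x} - #S) ^ 2
      = M * (M * ∑ h, (#{x ∈ S | P h x} : ℤ) ^ 2) - 2 * M * #S * ∑ h, (#{x ∈ S | P h x} : ℤ)
        + K * M * #S ^ 2 := by
    have : (K * M * #S ^ 2 : ℤ) = ∑ _h : H, (#S : ℤ) ^ 2 := by simp [hH]
    rw [this, mul_sum, mul_sum, mul_sum, ← sum_sub_distrib, ← sum_add_distrib]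
    exact sum_congr rfl fun h _ => by ring
  rw [e₃, e₁]
  nlinarith [mul_le_mul_of_nonneg_left e₂ (Int.natCast_nonneg M)]

open Finset in
/-- Chebyshev's inequality in counting form. -/
lemma card_filter_mul_sq_le {H : Type*} [Fintype H] (f : H → ℤ) (p : H → Prop) [DecidablePred p]
    (t : ℤ) (hp : ∀ h, p h → t ^ 2 ≤ f h ^ 2) : #{h | p h} * t ^ 2 ≤ ∑ h, f h ^ 2 := by
  calc (#{h | p h} * t ^ 2 : ℤ) = ∑ h with p h, t ^ 2 := by simp
    _ ≤ ∑ h with p h, f h ^ 2 := sum_le_sum fun h hh => hp h (by simpa using hh)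
    _ ≤ ∑ h, f h ^ 2 := sum_le_sum_of_subset_of_nonneg (filter_subset _ _)
        fun _ _ _ => sq_nonneg _

open Finset in
/-- Greedy covering: if every element of `A` is covered by at least half of `H`, then fewer than
`2 ^ n` elements are covered by `n` members of `H`. -/
lemma exists_cover_of_two_mul_card_le {H T : Type*} [Fintype H] [Nonempty H] (good : H → T → Prop)
    [∀ h τ, Decidable (good h τ)] (n : ℕ) (A : Finset T) (hA : #A < 2 ^ n)
    (h : ∀ τ ∈ A, 2 * #{h | ¬ good h τ} ≤ Fintype.card H) :
    ∃ f : Fin n → H, ∀ τ ∈ A, ∃ i, good (f i) τ := by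
  induction n generalizing A with
  | zero =>
    have : A = ∅ := by simpa using hA
    exact ⟨Fin.elim0, by simp [this]⟩
  | succ n ih =>
    obtain ⟨g, -, hg⟩ : ∃ g ∈ (univ : Finset H), 2 * #{τ ∈ A | ¬ good g τ} ≤ #A := by
      refine exists_le_of_sum_le univ_nonempty ?_
      calc ∑ g : H, 2 * #{τ ∈ A | ¬ good g τ}
          = ∑ τ ∈ A, 2 * #{g | ¬ good g τ} := by
            simp_rw [← mul_sum, card_filter]
            rw [sum_comm]
        _ ≤ ∑ τ ∈ A, Fintype.card H := sum_le_sum h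
        _ = ∑ _g : H, #A := by simp [mul_comm]
    obtain ⟨f, hf⟩ := ih {τ ∈ A | ¬ good g τ} (by rw [pow_succ] at hA; omega)
      fun τ hτ => h τ (mem_filter.1 hτ).1
    refine ⟨Fin.cons g f, fun τ hτ => ?_⟩
    by_cases hgτ : good g τ
    · exact ⟨0, hgτ⟩
    · obtain ⟨i, hi⟩ := hf τ (by simp [hτ, hgτ])
      exact ⟨i.succ, by simpa using hi⟩

open Finset in
/-- A nonzero vector is killed by a `1 / |F ^ m|` fraction of all matrices. -/
lemma card_mulVec_eq_zero_mul {m n F : Type*} [Fintype m] [Fintype n] [DecidableEq m]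
    [DecidableEq n] [Field F] [Fintype F] [DecidableEq F] (x : n → F) (hx : x ≠ 0) :
    #{U : Matrix m n F | U.mulVec x = 0} * Fintype.card (m → F)
      = Fintype.card (Matrix m n F) := by
  let φ : Matrix m n F →+ (m → F) :=
    { toFun := fun U => U.mulVec x
      map_zero' := Matrix.zero_mulVec x
      map_add' := fun A B => Matrix.add_mulVec A B x }
  have hφ : Function.Surjective φ := by
    intro y
    obtain ⟨j, hj⟩ := Function.ne_iff.1 hx
    refine ⟨Matrix.vecMulVec y (Pi.single j (x j)⁻¹), ?_⟩
    change (Matrix.vecMulVec y (Pi.single j (x j)⁻¹)).mulVec x = y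
    rw [Matrix.vecMulVec_mulVec, single_dotProduct, inv_mul_cancel₀ hj]
    simp
  have h := φ.ker.card_mul_index
  rw [AddSubgroup.index_ker, AddMonoidHom.range_eq_top.2 hφ, AddSubgroup.card_top,
    Nat.card_eq_fintype_card, Nat.card_eq_fintype_card (α := Matrix m n F)] at h
  rw [← h, ← Fintype.card_subtype, ← Nat.card_eq_fintype_card,
    ← Nat.card_eq_fintype_card, ← Nat.card_eq_fintype_card]
  rfl

open Finset in
/-- For each matrix `U` exactly one shift `v` makes `U x + v` vanish. -/
lemma card_affine_eq_zero {m n F : Type*} [Fintype m] [Fintype n] [DecidableEq m]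
    [DecidableEq n] [Field F] [Fintype F] [DecidableEq F] (p : Matrix m n F → Prop)
    [DecidablePred p] (x : n → F) :
    #{h : Matrix m n F × (m → F) | h.1.mulVec x + h.2 = 0 ∧ p h.1} = #{U | p U} := by
  refine card_bij' (fun h _ => h.1) (fun U _ => (U, -U.mulVec x)) ?_ ?_ ?_ ?_
  · intro h hh; simp_all
  · intro U hU; simp_all
  · rintro ⟨U, v⟩ hh
    simp only [mem_filter, mem_univ, true_and] at hh
    simp [neg_eq_of_add_eq_zero_right hh.1]
  · intro U _; rfl

open Finset in

/-- **Combinatorial core of the Encoding Lemma.**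
If every outcome of `R : {0,1}^ℓ → T` has at least `2^{ℓ-s}` preimages
(max-entropy at most `s`), then with `m = ℓ - s - 2` there exist `3s` affine
hash functions `σ ↦ U_i σ + v_i` such that every outcome `τ` of `R` has
a "working" index `i`: the system `U_i σ + v_i = 0` has at most `2^{s+3}`
solutions, and at least one solution `σ` with `R σ = τ`. -/
theorem stmt4 (ℓ s m : ℕ) (hs : 1 ≤ s) (hℓ : s + 2 ≤ ℓ) (hm : m = ℓ - s - 2)
    (T : Type*) (R : (Fin ℓ → ZMod 2) → T)
    (hR : ∀ τ ∈ Set.range R, 2 ^ (ℓ - s) ≤ Nat.card {σ : Fin ℓ → ZMod 2 // R σ = τ}) :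
    ∃ (U : Fin (3 * s) → Matrix (Fin m) (Fin ℓ) (ZMod 2))
      (v : Fin (3 * s) → (Fin m → ZMod 2)),
      ∀ τ ∈ Set.range R, ∃ i : Fin (3 * s),
        Nat.card {σ : Fin ℓ → ZMod 2 // (U i).mulVec σ + v i = 0} ≤ 2 ^ (s + 3)
        ∧ ∃ σ : Fin ℓ → ZMod 2, (U i).mulVec σ + v i = 0 ∧ R σ = τ := by
  classical
  let H := Matrix (Fin m) (Fin ℓ) (ZMod 2) × (Fin m → ZMod 2)
  let P : H → (Fin ℓ → ZMod 2) → Prop := fun h σ => h.1.mulVec σ + h.2 = 0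
  set K := Fintype.card (Matrix (Fin m) (Fin ℓ) (ZMod 2)) with hK
  have hM : Fintype.card (Fin m → ZMod 2) = 2 ^ m := by simp [ZMod.card]
  have hH : Fintype.card H = K * 2 ^ m := by rw [Fintype.card_prod, hM]
  have h₁ : ∀ σ, #{h | P h σ} = K := by
    intro σ
    simpa [P, hK, -Fintype.card_pi] using card_affine_eq_zero (m := Fin m) (fun _ => True) σ
  have h₂ : ∀ σ σ', σ ≠ σ' → #{h | P h σ ∧ P h σ'} * 2 ^ m = K := by
    intro σ σ' hne
    rw [hK, ← card_mulVec_eq_zero_mul (σ' - σ) (sub_ne_zero.2 hne.symm), hM,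
      ← card_affine_eq_zero _ σ]
    congr 3 with h
    refine and_congr_right fun hσ => ?_
    change _ + _ = 0 at hσ
    change _ + _ = 0 ↔ _
    rw [Matrix.mulVec_sub, sub_eq_zero, ← hσ, add_left_inj]
  have hvar := sum_sq_card_filter_sub_le P K (2 ^ m) hH h₁ h₂
  have hcard : #(univ.image R) < 2 ^ (3 * s) := by
    have hfib : #(univ.image R) * 2 ^ (ℓ - s) ≤ 2 ^ s * 2 ^ (ℓ - s) := by
      rw [← pow_add, Nat.add_sub_cancel' (by omega)]
      have := card_eq_sum_card_image R univ
      rw [card_univ, Fintype.card_fun, ZMod.card, Fintype.card_fin] at this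
      rw [this, ← smul_eq_mul]
      refine card_nsmul_le_sum _ _ _ fun τ hτ => ?_
      have := hR τ (by simpa using hτ)
      rwa [Nat.card_eq_fintype_card, Fintype.card_subtype] at this
    exact (Nat.le_of_mul_le_mul_right hfib (by positivity)).trans_lt
      (Nat.pow_lt_pow_right (by norm_num) (by omega))
  have hhalf : ∀ τ ∈ univ.image R,
      2 * #{h : H | ¬ (#{σ | P h σ} ≤ 2 ^ (s + 3) ∧ ∃ σ, P h σ ∧ R σ = τ)}
        ≤ Fintype.card H := by
    intro τ hτ
    set S : Finset (Fin ℓ → ZMod 2) := {σ | R σ = τ} with hS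
    have hScard : 4 * 2 ^ m ≤ #S := by
      have := hR τ (by simpa using hτ)
      rw [Nat.card_eq_fintype_card, Fintype.card_subtype] at this
      rwa [show ℓ - s = 2 + m by omega, pow_add] at this
    have hmiss : 4 * #{h | #{σ ∈ S | P h σ} = 0} ≤ K * 2 ^ m := by
      have h := (card_filter_mul_sq_le
        (fun h => ((2 ^ m : ℕ) : ℤ) * #{σ ∈ S | P h σ} - #S) (fun h => #{σ ∈ S | P h σ} = 0)
        (#S) (fun h hh => by simp [hh])).trans (hvar S)
      norm_cast at h
      have hpos : 0 < #S := lt_of_lt_of_le (by positivity) hScard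
      generalize #{h | #{σ ∈ S | P h σ} = 0} = a at h ⊢
      have h' : a * #S ≤ K * (2 ^ m) ^ 2 := Nat.le_of_mul_le_mul_right (by linarith) hpos
      refine Nat.le_of_mul_le_mul_right (c := 2 ^ m) ?_ (by positivity)
      nlinarith [Nat.mul_le_mul_left a hScard]
    have hmany : 8 * #{h | 2 ^ (s + 3) < #{σ | P h σ}} ≤ K * 2 ^ m := by
      have huniv : #(univ : Finset (Fin ℓ → ZMod 2)) = 2 ^ m * 2 ^ (s + 2) := by
        rw [card_univ, Fintype.card_fun, ZMod.card, Fintype.card_fin, ← pow_add]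
        congr 1
        omega
      have h := (card_filter_mul_sq_le
        (fun h => ((2 ^ m : ℕ) : ℤ) * #{σ | P h σ} - #(univ : Finset (Fin ℓ → ZMod 2)))
        (fun h => 2 ^ (s + 3) < #{σ | P h σ})
        ((2 ^ m * 2 ^ (s + 2) : ℕ) : ℤ) (fun h hh => by
          rw [huniv]
          refine pow_le_pow_left₀ (by positivity) ?_ 2
          have h3 : 2 ^ m * (2 * 2 ^ (s + 2)) ≤ 2 ^ m * #{σ | P h σ} :=
            Nat.mul_le_mul_left _ (by rw [← pow_succ']; exact hh.le)
          zify at h3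
          push_cast
          linarith)).trans (hvar univ)
      rw [huniv] at h
      norm_cast at h
      generalize #{h | 2 ^ (s + 3) < #{σ | P h σ}} = b at h ⊢
      have h8 : 8 ≤ 2 ^ (s + 2) := by
        calc 8 = 2 ^ 3 := by norm_num
          _ ≤ 2 ^ (s + 2) := Nat.pow_le_pow_right (by norm_num) (by omega)
      have hpos : 0 < (2 ^ m) ^ 2 * 2 ^ (s + 2) := by positivity
      have h' : b * 2 ^ (s + 2) ≤ K * 2 ^ m :=
        Nat.le_of_mul_le_mul_right (by linarith) hpos
      nlinarith [Nat.mul_le_mul_left b h8]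
    have hbad : #{h : H | ¬ (#{σ | P h σ} ≤ 2 ^ (s + 3) ∧ ∃ σ, P h σ ∧ R σ = τ)}
        ≤ #{h | 2 ^ (s + 3) < #{σ | P h σ}} + #{h | #{σ ∈ S | P h σ} = 0} := by
      refine (card_le_card fun h hh => ?_).trans (card_union_le _ _)
      simp only [mem_union, mem_filter, mem_univ, true_and, not_and_or, not_le] at hh ⊢
      refine hh.imp id fun hne => ?_
      rw [card_eq_zero, filter_eq_empty_iff]
      exact fun σ hσ hP => hne ⟨σ, hP, by simpa [hS] using hσ⟩
    rw [hH]
    omega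
  obtain ⟨f, hf⟩ := exists_cover_of_two_mul_card_le
    (fun (h : H) τ => #{σ | P h σ} ≤ 2 ^ (s + 3) ∧ ∃ σ, P h σ ∧ R σ = τ) (3 * s)
    (univ.image R) hcard hhalf
  refine ⟨fun i => (f i).1, fun i => (f i).2, ?_⟩
  rintro τ ⟨σ, rfl⟩
  obtain ⟨i, hi, hi'⟩ := hf (R σ) (by simp)
  refine ⟨i, ?_, hi'⟩
  rwa [Nat.card_eq_fintype_card, Fintype.card_subtype]
end

section
/- Let n, t be natural numbers and let G0, G1 be simple graphs on vertex set Fin n that are both rigid (Subsingleton (G0 ≃g G0) and Subsingleton (G1 ≃g G1)) and nonisomorphic (IsEmpty (G0 ≃g G1)). Then the map Φ from (Fin t → Bool) × (Fin t → Equiv.Perm (Fin n)) to (Fin t → SimpleGraph (Fin n)) defined by Φ(r, π) i = (π i) • (G_{r i}) (where G_false = G0 and G_true = G1) is injective. -/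
/-- Two relabelings `π • G = σ • H` that agree give the isomorphism `σ⁻¹ * π` from `G` to `H`. -/
theorem exists_iso_of_map_eq_map {V : Type*} {G H : SimpleGraph V} {π σ : Equiv.Perm V}
    (h : G.map π.toEmbedding = H.map σ.toEmbedding) :
    ∃ e : G ≃g H, ∀ v, σ (e v) = π v := by
  refine ⟨⟨π.trans σ.symm, fun {u v} => ?_⟩, fun v => σ.apply_symm_apply (π v)⟩
  rw [← SimpleGraph.map_adj_apply (G := H) (f := σ.toEmbedding), ← h]
  simpa using SimpleGraph.map_adj_apply (G := G) (f := π.toEmbedding) (a := u) (b := v)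

/-- A rigid graph has trivial stabilizer under relabeling. -/
theorem perm_eq_of_map_eq_map {V : Type*} {G : SimpleGraph V} [Subsingleton (G ≃g G)]
    {π σ : Equiv.Perm V} (h : G.map π.toEmbedding = G.map σ.toEmbedding) : π = σ := by
  obtain ⟨e, he⟩ := exists_iso_of_map_eq_map h
  ext1 v
  rw [← he v, Subsingleton.elim e SimpleGraph.Iso.refl]
  rfl

/-- **Rigid nonisomorphic case: the samples determine the coins and permutations.**
If `G0, G1` are rigid, nonisomorphic simple graphs on `Fin n`, then the map
`(r, π) ↦ (i ↦ (π i) • G_{r i})`, sending `t` coin flips and `t` permutations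
to the corresponding sequence of permuted copies, is injective. -/
theorem stmt5 (n t : ℕ) (G0 G1 : SimpleGraph (Fin n))
    (h0 : Subsingleton (G0 ≃g G0)) (h1 : Subsingleton (G1 ≃g G1))
    (hne : IsEmpty (G0 ≃g G1)) :
    Function.Injective (fun p : (Fin t → Bool) × (Fin t → Equiv.Perm (Fin n)) =>
      fun i : Fin t => (bif p.1 i then G1 else G0).map (p.2 i).toEmbedding) := by
  rintro ⟨r, π⟩ ⟨s, σ⟩ h
  have key (i : Fin t) : r i = s i ∧ π i = σ i := by
    have hi := congrFun h i
    dsimp only at hi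
    cases hr : r i <;> cases hs : s i <;> simp only [hr, hs, cond_true, cond_false] at hi
    · exact ⟨rfl, perm_eq_of_map_eq_map hi⟩
    · exact (hne.false (exists_iso_of_map_eq_map hi).choose).elim
    · exact (hne.false (exists_iso_of_map_eq_map hi.symm).choose).elim
    · exact ⟨rfl, perm_eq_of_map_eq_map hi⟩
  exact Prod.ext (funext fun i => (key i).1) (funext fun i => (key i).2)
end

section
/- Let G be a group, m a natural number, and K : Fin (m+1) → Subgroup G a descending chain of subgroups (K j ≤ K i whenever i ≤ j) with K m equal to the trivial subgroup ⊥. Suppose S : Fin m → Set G satisfies, for each i: S i ⊆ K i (as i ranges over Fin m, identifying i with its cast into Fin (m+1)), and every left coset of K (i+1) inside K i contains an element of S i, i.e., for every x ∈ K i there exists a ∈ S i with a⁻¹ * x ∈ K (i+1). Then the subgroup generated by the union ⋃ i, S i equals K 0. -/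
/-- **Correctness of the normal form for permutation groups (generation).**
Given a descending chain of subgroups `K 0 ≥ K 1 ≥ ⋯ ≥ K m = ⊥` and, for each
step `i`, a set `S i ⊆ K i` hitting every left coset of `K (i+1)` inside `K i`,
the union of the `S i` generates `K 0`. -/
theorem stmt8 (G : Type*) [Group G] (m : ℕ) (K : Fin (m + 1) → Subgroup G)
    (hanti : ∀ i j : Fin (m + 1), i ≤ j → K j ≤ K i)
    (hlast : K (Fin.last m) = ⊥)
    (S : Fin m → Set G)
    (hsub : ∀ i : Fin m, S i ⊆ (K i.castSucc : Set G))
    (hcov : ∀ i : Fin m, ∀ x ∈ K i.castSucc, ∃ a ∈ S i, a⁻¹ * x ∈ K i.succ) :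
    Subgroup.closure (⋃ i, S i) = K 0 := by
  refine le_antisymm ?_ ?_
  · rw [Subgroup.closure_le]
    exact Set.iUnion_subset fun i => (hsub i).trans (hanti 0 i.castSucc (Fin.zero_le _))
  · suffices h : ∀ i, K i ≤ Subgroup.closure (⋃ i, S i) from h 0
    intro i
    induction i using Fin.reverseInduction with
    | last => exact hlast ▸ bot_le
    | cast i ih =>
      intro x hx
      obtain ⟨a, ha, hax⟩ := hcov i x hx
      simpa using mul_mem (Subgroup.subset_closure (Set.mem_iUnion_of_mem i ha)) (ih hax)
end

section
/- Let n be a natural number, Γ ≤ H subgroups of Equiv.Perm (Fin n), A a subset of Fin n, and σ an element of H. Then the number of distinct left cosets π·Γ (with π ∈ H) that contain at least one element agreeing with σ on A (i.e., some π' with π' a = σ a for all a ∈ A), multiplied by the cardinality of Γ_A = Γ ⊓ H_A, equals the cardinality of the pointwise stabilizer H_A. Equivalently, this number of cosets equals the index |H_A| / |Γ_A|. -/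
/-- The pointwise stabilizer `H_A` of a set `A ⊆ Fin n` inside a subgroup
`H ≤ Sym(Fin n)`: the elements of `H` fixing every point of `A`. -/
def pointwiseStabilizer {n : ℕ} (H : Subgroup (Equiv.Perm (Fin n))) (A : Set (Fin n)) :
    Subgroup (Equiv.Perm (Fin n)) :=
  H ⊓ ⨅ a ∈ A, MulAction.stabilizer (Equiv.Perm (Fin n)) a

theorem mem_pointwiseStabilizer {n : ℕ} {H : Subgroup (Equiv.Perm (Fin n))} {A : Set (Fin n)}
    {h : Equiv.Perm (Fin n)} :
    h ∈ pointwiseStabilizer H A ↔ h ∈ H ∧ ∀ a ∈ A, h a = a := by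
  simp [pointwiseStabilizer, Subgroup.mem_iInf]

/-- The left cosets of `Γ` meeting the translate `g * K` are counted by the relative index of
`Γ` in `K`. -/
theorem card_cosets_meeting_translate {G : Type*} [Group G] (Γ K : Subgroup G) (g : G) :
    Nat.card {c : G ⧸ Γ // ∃ k ∈ K, (QuotientGroup.mk (g * k) : G ⧸ Γ) = c} =
      Γ.relIndex K := by
  let f : K ⧸ Γ.subgroupOf K →
      {c : G ⧸ Γ // ∃ k ∈ K, (QuotientGroup.mk (g * k) : G ⧸ Γ) = c} :=
    Quotient.lift (fun k : K => ⟨QuotientGroup.mk (g * k), k, k.2, rfl⟩) fun a b hab => by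
      have hab := QuotientGroup.leftRel_apply.mp hab
      refine Subtype.ext (QuotientGroup.eq.mpr ?_)
      simpa [Subgroup.mem_subgroupOf, mul_assoc] using hab
  refine (Nat.card_congr (Equiv.ofBijective f ⟨?_, ?_⟩)).symm
  · intro x y
    induction x using QuotientGroup.induction_on with | H a => ?_
    induction y using QuotientGroup.induction_on with | H b => ?_
    intro hab
    have hab := QuotientGroup.eq.mp (congrArg Subtype.val hab)
    refine QuotientGroup.eq.mpr ?_
    simpa [Subgroup.mem_subgroupOf, mul_assoc] using hab
  · rintro ⟨_, k, hk, rfl⟩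
    exact ⟨QuotientGroup.mk ⟨k, hk⟩, rfl⟩

/-- **Counting cosets extending a partial assignment.**
For `Γ ≤ H ≤ Sym(Fin n)`, `A ⊆ Fin n` and `σ ∈ H`, the number of left cosets
of `Γ` containing some `π ∈ H` that agrees with `σ` on `A`, multiplied by
`|Γ_A|` (where `Γ_A = Γ ⊓ H_A`), equals `|H_A|`. -/
theorem stmt11 (n : ℕ) (Γ H : Subgroup (Equiv.Perm (Fin n))) (hΓH : Γ ≤ H)
    (A : Set (Fin n)) (σ : Equiv.Perm (Fin n)) (hσ : σ ∈ H) :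
    Nat.card {c : Equiv.Perm (Fin n) ⧸ Γ // ∃ π ∈ H, (∀ a ∈ A, π a = σ a) ∧
        (QuotientGroup.mk π : Equiv.Perm (Fin n) ⧸ Γ) = c}
      * Nat.card ↥(Γ ⊓ pointwiseStabilizer H A)
    = Nat.card ↥(pointwiseStabilizer H A) := by
  have hcosets (c : Equiv.Perm (Fin n) ⧸ Γ) :
      (∃ π ∈ H, (∀ a ∈ A, π a = σ a) ∧ (QuotientGroup.mk π : Equiv.Perm (Fin n) ⧸ Γ) = c) ↔
        ∃ k ∈ pointwiseStabilizer H A,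
          (QuotientGroup.mk (σ * k) : Equiv.Perm (Fin n) ⧸ Γ) = c := by
    constructor
    · rintro ⟨π, hπ, hA, rfl⟩
      refine ⟨σ⁻¹ * π, mem_pointwiseStabilizer.mpr ⟨H.mul_mem (H.inv_mem hσ) hπ, ?_⟩, by simp⟩
      intro a ha
      simp [hA a ha]
    · rintro ⟨k, hk, rfl⟩
      obtain ⟨hkH, hkA⟩ := mem_pointwiseStabilizer.mp hk
      exact ⟨σ * k, H.mul_mem hσ hkH, fun a ha => by simp [hkA a ha], rfl⟩
  rw [Nat.card_congr (Equiv.subtypeEquivRight hcosets), card_cosets_meeting_translate,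
    ← Subgroup.inf_relIndex_right, mul_comm, ← Subgroup.relIndex_bot_left,
    Subgroup.relIndex_mul_relIndex _ _ _ bot_le inf_le_right, Subgroup.relIndex_bot_left]
end

section
/- For every finite field F and every natural number n, the general linear group satisfies 4 · |GL_n(F)| ≥ q^(n²), where q = Fintype.card F; that is, the proportion of invertible matrices among all n × n matrices over F is greater than 1/4 (a positive constant independent of n and q). -/
/-- Strengthening of `q ^ (n ^ 2) ≤ 4 * ∏ i < n, (q ^ n - q ^ i)` that is stable under induction. -/
lemma pow_sq_mul_le_four_mul_prod_pow_sub_pow (q : ℤ) (hq : 2 ≤ q) (n : ℕ) (hn : 1 ≤ n) :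
    q ^ (n ^ 2) * (q ^ n + 2) ≤ 4 * q ^ n * ∏ i ∈ Finset.range n, (q ^ n - q ^ i) := by
  induction n, hn using Nat.le_induction with
  | base => simp; nlinarith
  | succ n hn ih =>
    have hprod : ∏ i ∈ Finset.range (n + 1), (q ^ (n + 1) - q ^ i) =
        q ^ n * (∏ i ∈ Finset.range n, (q ^ n - q ^ i)) * (q ^ (n + 1) - 1) := by
      rw [Finset.prod_range_succ', pow_zero]
      congr 1
      calc _ = ∏ i ∈ Finset.range n, q * (q ^ n - q ^ i) :=
            Finset.prod_congr rfl fun i _ => by ring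
        _ = _ := by rw [Finset.prod_mul_distrib, Finset.prod_const, Finset.card_range]
    have hQ : 2 ≤ q ^ n := hq.trans (le_self_pow₀ (by lia) (by lia))
    have hA : 0 ≤ q ^ (n ^ 2) := by positivity
    rw [hprod, show q ^ (n + 1) ^ 2 = q ^ (n ^ 2) * (q ^ n) ^ 2 * q by ring, pow_succ q n]
    generalize (∏ i ∈ Finset.range n, (q ^ n - q ^ i)) = R at *
    generalize q ^ (n ^ 2) = A at *
    generalize q ^ n = Q at *
    have hqQ : 2 * Q ≤ Q * q := by nlinarith
    have hstep : Q * (Q * q + 2) ≤ (Q + 2) * (Q * q - 1) := by nlinarith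
    calc A * Q ^ 2 * q * (Q * q + 2) = A * (Q * q) * (Q * (Q * q + 2)) := by ring
      _ ≤ A * (Q * q) * ((Q + 2) * (Q * q - 1)) := by gcongr
      _ = Q * q * (Q * q - 1) * (A * (Q + 2)) := by ring
      _ ≤ Q * q * (Q * q - 1) * (4 * Q * R) :=
          mul_le_mul_of_nonneg_left ih (mul_nonneg (by lia) (by lia))
      _ = 4 * (Q * q) * (Q * R * (Q * q - 1)) := by ring

/-- **Invertible matrices are at least a quarter of all matrices.**
For every finite field `F` with `q = |F|` and every `n`,
`4 · |GL_n(F)| ≥ q^(n²)`. -/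
theorem stmt13 (F : Type*) [Field F] [Fintype F] (n : ℕ) :
    (Fintype.card F) ^ (n ^ 2) ≤ 4 * Nat.card (GL (Fin n) F) := by
  rw [Matrix.card_GL_field]
  have hq : 2 ≤ Fintype.card F := Fintype.one_lt_card
  generalize Fintype.card F = q at *
  rw [Fin.prod_univ_eq_prod_range (fun i => q ^ n - q ^ i) n]
  rcases Nat.eq_zero_or_pos n with rfl | hn
  · simp
  have hcast : ((∏ i ∈ Finset.range n, (q ^ n - q ^ i) : ℕ) : ℤ) =
      ∏ i ∈ Finset.range n, ((q : ℤ) ^ n - (q : ℤ) ^ i) := by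
    rw [Nat.cast_prod]
    refine Finset.prod_congr rfl fun i hi => ?_
    rw [Nat.cast_sub (Nat.pow_le_pow_right (by lia) (Finset.mem_range.mp hi).le)]
    push_cast
    rfl
  have h := pow_sq_mul_le_four_mul_prod_pow_sub_pow q (by exact_mod_cast hq) n hn
  rw [← hcast] at h
  norm_cast at h
  have hQ : 0 < q ^ n := by positivity
  refine Nat.le_of_mul_le_mul_right ?_ hQ
  calc q ^ (n ^ 2) * q ^ n ≤ q ^ (n ^ 2) * (q ^ n + 2) := by gcongr; lia
    _ ≤ _ := h
    _ = _ := by ring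
end
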